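/- For any 1/2 < s < 5/2, the operator T^c₁(u) := u² sgn(x) maps the space H^s_o of odd 2π-periodic functions of Sobolev class H^s into itself, and there exists a constant C₇(s) such that ‖u² sgn(x)‖_s ≤ C₇ ‖u‖²_s for all u ∈ H^s_o. -/

import Mathlib

noncomputable section

/-- `[k] = max {1, |k|}`. -/
def br (k : ℤ) : ℝ := max 1 |(k : ℝ)|

/-- Fourier coefficients of a 2π-periodic function (orthonormal complex exponential basis). -/
def fcoeff (u : ℝ → ℂ) (k : ℤ) : ℂ :=
  (∫ x in (-Real.pi)..Real.pi, u x * Complex.exp (-Complex.I * k * x)) / Real.sqrt (2*Real.pi)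

/-- the Sobolev norm `‖u‖_s = (∑_k [k]^{2s} |û_k|²)^{1/2}`. -/
def snorm (s : ℝ) (u : ℝ → ℂ) : ℝ := Real.sqrt (∑' k : ℤ, br k ^ (2*s) * ‖fcoeff u k‖^2)

open scoped ENNReal

/-! ### Summation inequalities in `ℝ≥0∞` -/

theorem ENNReal.two_mul_le_sq_add_sq (a b : ℝ≥0∞) : 2 * (a * b) ≤ a ^ 2 + b ^ 2 := by
  by_cases ha : a = ∞
  · simp [ha]
  by_cases hb : b = ∞
  · simp [hb]
  lift a to NNReal using ha
  lift b to NNReal using hb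
  norm_cast
  rw [← mul_assoc]
  exact two_mul_le_add_sq a b

/-- Weighted Cauchy–Schwarz inequality for sums in `ℝ≥0∞`. -/
theorem ENNReal.sq_tsum_mul_mul_le {ι : Type*} (w f g : ι → ℝ≥0∞) :
    (∑' i, w i * f i * g i) ^ 2 ≤ (∑' i, w i * f i ^ 2) * ∑' i, w i * g i ^ 2 := by
  have prod_eq : ∀ a b : ι → ℝ≥0∞, (∑' i, a i) * ∑' j, b j = ∑' i, ∑' j, a i * b j := by
    intro a b
    simp_rw [← ENNReal.tsum_mul_right, ← ENNReal.tsum_mul_left]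
  have h : 2 * (∑' i, w i * f i * g i) ^ 2 ≤
      2 * ((∑' i, w i * f i ^ 2) * ∑' i, w i * g i ^ 2) := by
    rw [two_mul (_ * _)]
    nth_rewrite 3 [mul_comm]
    rw [sq, prod_eq, prod_eq, prod_eq, ← ENNReal.tsum_mul_left, ← ENNReal.tsum_add]
    refine ENNReal.tsum_le_tsum fun i => ?_
    rw [← ENNReal.tsum_mul_left, ← ENNReal.tsum_add]
    refine ENNReal.tsum_le_tsum fun j => ?_
    calc 2 * (w i * f i * g i * (w j * f j * g j))
        = w i * w j * (2 * ((f i * g j) * (g i * f j))) := by ring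
      _ ≤ w i * w j * ((f i * g j) ^ 2 + (g i * f j) ^ 2) := by
        gcongr; exact ENNReal.two_mul_le_sq_add_sq _ _
      _ = _ := by ring
  rwa [ENNReal.mul_le_mul_iff_right (by simp) (by simp)] at h

theorem ENNReal.sq_tsum_mul_le {ι : Type*} (f g : ι → ℝ≥0∞) :
    (∑' i, f i * g i) ^ 2 ≤ (∑' i, f i ^ 2) * ∑' i, g i ^ 2 := by
  simpa using ENNReal.sq_tsum_mul_mul_le (fun _ => 1) f g

/-- A Schur-type test: a kernel uniformly summable in each of two variables acts boundedly
from `ℓ¹ × ℓ²` to `ℓ²`. -/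
theorem ENNReal.tsum_sq_tsum_kernel_le {ι κ μ : Type*} (Φ : κ → μ → ι → ℝ≥0∞) (Z : ℝ≥0∞)
    (h1 : ∀ m n, ∑' k, Φ k m n ≤ Z) (h2 : ∀ k n, ∑' m, Φ k m n ≤ Z)
    (α : ι → ℝ≥0∞) (β : μ → ℝ≥0∞) :
    ∑' k, (∑' n, ∑' m, α n * Φ k m n * β m) ^ 2 ≤ Z ^ 2 * (∑' n, α n) ^ 2 * ∑' m, β m ^ 2 := by
  have key : ∀ k, (∑' n, ∑' m, α n * Φ k m n * β m) ^ 2 ≤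
      (Z * ∑' n, α n) * ∑' n, ∑' m, α n * Φ k m n * β m ^ 2 := by
    intro k
    have h := ENNReal.sq_tsum_mul_mul_le (fun p : ι × μ => α p.1 * Φ k p.2 p.1)
      (fun _ => 1) (fun p => β p.2)
    simp only [mul_one, one_pow] at h
    rw [ENNReal.tsum_prod (f := fun n m => α n * Φ k m n * β m),
      ENNReal.tsum_prod (f := fun n m => α n * Φ k m n),
      ENNReal.tsum_prod (f := fun n m => α n * Φ k m n * β m ^ 2)] at h
    refine h.trans ?_
    gcongr
    rw [← ENNReal.tsum_mul_left]
    refine ENNReal.tsum_le_tsum fun n => ?_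
    rw [ENNReal.tsum_mul_left, mul_comm]
    gcongr
    exact h2 k n
  calc ∑' k, (∑' n, ∑' m, α n * Φ k m n * β m) ^ 2
      ≤ ∑' k, (Z * ∑' n, α n) * ∑' n, ∑' m, α n * Φ k m n * β m ^ 2 :=
        ENNReal.tsum_le_tsum key
    _ = (Z * ∑' n, α n) * ∑' n, ∑' m, ∑' k, α n * β m ^ 2 * Φ k m n := by
        rw [ENNReal.tsum_mul_left, ENNReal.tsum_comm]
        congr 1
        refine tsum_congr fun n => ?_
        rw [ENNReal.tsum_comm]
        exact tsum_congr fun m => tsum_congr fun k => by ring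
    _ ≤ (Z * ∑' n, α n) * ∑' n, ∑' m, α n * β m ^ 2 * Z := by
        gcongr with n m
        rw [ENNReal.tsum_mul_left]
        gcongr
        exact h1 m n
    _ = _ := by
        simp_rw [ENNReal.tsum_mul_right, ENNReal.tsum_mul_left, ENNReal.tsum_mul_right]
        ring

/-! ### The integrals of products of three sines -/

/-- The integral over `[0, π]` of `sin (k x) sin (m x) sin (n x)`. -/
def sinTriple (k m n : ℤ) : ℝ :=
  ∫ x in (0 : ℝ)..Real.pi, Real.sin (k * x) * Real.sin (m * x) * Real.sin (n * x)

theorem sinTriple_swap (k m n : ℤ) : sinTriple k m n = sinTriple k n m := by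
  simp only [sinTriple]
  congr 1
  ext x
  ring

theorem integral_sin_int_mul (j : ℤ) :
    ∫ x in (0 : ℝ)..Real.pi, Real.sin (j * x) = (1 - (-1) ^ j) / j := by
  by_cases hj : j = 0
  · simp [hj]
  have hj' : (j : ℝ) ≠ 0 := by exact_mod_cast hj
  rw [intervalIntegral.integral_comp_mul_left Real.sin hj', integral_sin, Real.cos_int_mul_pi]
  simp
  field_simp

theorem sinTriple_eq (k m n : ℤ) :
    sinTriple k m n = ((1 - (-1) ^ (k + m - n)) / ((k + m - n : ℤ) : ℝ)
      + (1 - (-1) ^ (k - m + n)) / ((k - m + n : ℤ) : ℝ)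
      - (1 - (-1) ^ (k - m - n)) / ((k - m - n : ℤ) : ℝ)
      - (1 - (-1) ^ (k + m + n)) / ((k + m + n : ℤ) : ℝ)) / 4 := by
  have hi : ∀ j : ℤ, IntervalIntegrable (fun x : ℝ => Real.sin (j * x)) MeasureTheory.volume
      0 Real.pi := fun j => Continuous.intervalIntegrable (by fun_prop) _ _
  rw [← integral_sin_int_mul, ← integral_sin_int_mul, ← integral_sin_int_mul,
    ← integral_sin_int_mul, ← intervalIntegral.integral_add (hi _) (hi _),
    ← intervalIntegral.integral_sub ((hi _).add (hi _)) (hi _),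
    ← intervalIntegral.integral_sub (((hi _).add (hi _)).sub (hi _)) (hi _),
    ← intervalIntegral.integral_div, sinTriple]
  congr 1
  ext x
  push_cast
  simp only [add_mul, sub_mul, Real.sin_add, Real.sin_sub, Real.cos_add, Real.cos_sub]
  ring

theorem sinTriple_of_even {k m n : ℤ} (h : Even (k + m + n)) : sinTriple k m n = 0 := by
  have h1 : Even (k + m - n) := by grind
  have h2 : Even (k - m + n) := by grind
  have h3 : Even (k - m - n) := by grind
  rw [sinTriple_eq, h.neg_one_zpow, h1.neg_one_zpow, h2.neg_one_zpow, h3.neg_one_zpow]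
  simp

theorem sinTriple_mul_of_odd {k m n : ℤ} (h : Odd (k + m + n)) :
    sinTriple k m n * (((k - m - n : ℤ) : ℝ) * ((k - m + n : ℤ) : ℝ) * ((k + m - n : ℤ) : ℝ)
      * ((k + m + n : ℤ) : ℝ)) = -(4 * k * m * n) := by
  have h1 : Odd (k + m - n) := by grind
  have h2 : Odd (k - m + n) := by grind
  have h3 : Odd (k - m - n) := by grind
  have e0 : ((k + m + n : ℤ) : ℝ) ≠ 0 := by
    norm_cast; rintro h'; rw [h'] at h; exact absurd h (by decide)
  have e1 : ((k + m - n : ℤ) : ℝ) ≠ 0 := by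
    norm_cast; rintro h'; rw [h'] at h1; exact absurd h1 (by decide)
  have e2 : ((k - m + n : ℤ) : ℝ) ≠ 0 := by
    norm_cast; rintro h'; rw [h'] at h2; exact absurd h2 (by decide)
  have e3 : ((k - m - n : ℤ) : ℝ) ≠ 0 := by
    norm_cast; rintro h'; rw [h'] at h3; exact absurd h3 (by decide)
  rw [sinTriple_eq, h.neg_one_zpow, h1.neg_one_zpow, h2.neg_one_zpow, h3.neg_one_zpow]
  field_simp
  push_cast
  ring

/-! ### Pointwise bounds for the weighted kernel -/

theorem one_le_br (k : ℤ) : 1 ≤ br k := le_max_left _ _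

theorem br_pos (k : ℤ) : 0 < br k := one_pos.trans_le (one_le_br k)

theorem br_of_ne_zero {k : ℤ} (hk : k ≠ 0) : br k = |(k : ℝ)| := by
  have : (1 : ℝ) ≤ |(k : ℝ)| := by exact_mod_cast Int.one_le_abs hk
  exact max_eq_right this

theorem br_neg (k : ℤ) : br (-k) = br k := by simp [br]

theorem summable_br_rpow {p : ℝ} (hp : p < -1) : Summable fun j : ℤ => br j ^ p := by
  have h := Real.summable_abs_int_rpow (b := -p) (by linarith)
  rw [neg_neg] at h
  refine h.congr_cofinite ?_
  filter_upwards [(Set.finite_singleton (0 : ℤ)).compl_mem_cofinite] with j hj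
  rw [br_of_ne_zero hj]

theorem tsum_int_br_rpow_ne_top {p : ℝ} (hp : p < -1) :
    ∑' j : ℤ, ENNReal.ofReal (br j ^ p) ≠ ∞ :=
  (summable_br_rpow hp).tsum_ofReal_ne_top

theorem tsum_nat_br_rpow_ne_top {p : ℝ} (hp : p < -1) :
    ∑' j : ℕ, ENNReal.ofReal (br j ^ p) ≠ ∞ :=
  ne_top_of_le_ne_top (tsum_int_br_rpow_ne_top hp)
    (ENNReal.tsum_comp_le_tsum_of_injective Nat.cast_injective
      fun j : ℤ => ENNReal.ofReal (br j ^ p))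

theorem div_mul_le_rpow {n p q ε : ℝ} (hp : 1 ≤ p) (hpq : p ≤ q) (hn : 0 < n) (hnq : n ≤ q)
    (hε : 0 < ε) (hε1 : ε ≤ 1) : n / (p * q) ≤ n ^ ε * p ^ (-(1 + ε)) := by
  have hp0 : 0 < p := by linarith
  have hq0 : 0 < q := by linarith
  have h1 : n ^ (1 - ε) * p ^ ε ≤ q := by
    calc n ^ (1 - ε) * p ^ ε ≤ q ^ (1 - ε) * q ^ ε := by
          gcongr
      _ = q := by rw [← Real.rpow_add hq0]; simp
  have h2 : n ^ (1 - ε) * n ^ ε = n := by rw [← Real.rpow_add hn]; simp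
  have h3 : p ^ (-(1 + ε)) * (p * p ^ ε) = 1 := by
    rw [← Real.rpow_one_add' hp0.le (by linarith), ← Real.rpow_add hp0]; simp
  rw [div_le_iff₀ (by positivity)]
  calc n = n ^ ε * (n ^ (1 - ε)) * (p ^ (-(1 + ε)) * (p * p ^ ε)) := by
        rw [h3]; linarith
    _ = n ^ ε * p ^ (-(1 + ε)) * p * (n ^ (1 - ε) * p ^ ε) := by ring
    _ ≤ n ^ ε * p ^ (-(1 + ε)) * p * q := by gcongr
    _ = _ := by ring

theorem kernel_far_le {k m n s τ S P : ℝ} (hn : 1 ≤ n) (hnm : n ≤ m) (hk : 4 * m ≤ k)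
    (hτ : 0 ≤ τ) (hS : 0 ≤ S) (hP : (k - m - n) * (k - m + n) * (k + m - n) * (k + m + n) ≤ P)
    (h : S * P = 4 * k * m * n) :
    k ^ s * S ≤ m ^ s * n ^ s *
      (16 * (k ^ (s - 3 + τ) * m ^ (1 - s - τ / 2) * n ^ (1 - s - τ / 2))) := by
  have hk0 : 0 < k := by linarith
  have hm0 : 0 < m := by linarith
  have hn0 : 0 < n := by linarith
  have hP' : k / 2 * (k / 2) * k * k ≤ P := by
    refine le_trans ?_ hP
    have h1 : k / 2 ≤ k - m - n := by linarith
    have h2 : k / 2 ≤ k - m + n := by linarith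
    have h3 : 0 < k - m - n := by linarith
    have h4 : 0 < k - m + n := by linarith
    have h5 : 0 < k + m - n := by linarith
    gcongr <;> linarith
  have h1 : S * k ^ 3 ≤ 16 * (m * n) := by
    have : S * (k / 2 * (k / 2) * k * k) ≤ 4 * k * m * n := by
      rw [← h]; gcongr
    have h2 : k * (S * k ^ 3) ≤ k * (16 * (m * n)) := by linarith
    exact le_of_mul_le_mul_left h2 hk0
  have ek : k ^ s = k ^ (s - 3) * k ^ 3 := by
    rw [← Real.rpow_natCast, ← Real.rpow_add hk0]; norm_num
  have ek' : k ^ (s - 3 + τ) = k ^ (s - 3) * (k ^ (τ / 2) * k ^ (τ / 2)) := by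
    rw [← Real.rpow_add hk0, ← Real.rpow_add hk0]; ring_nf
  have hw : ∀ x : ℝ, 0 < x → x ^ s * x ^ (1 - s - τ / 2) * x ^ (τ / 2) = x := by
    intro x hx
    rw [← Real.rpow_add hx, ← Real.rpow_add hx]; ring_nf; simp
  calc k ^ s * S = k ^ (s - 3) * (S * k ^ 3) := by rw [ek]; ring
    _ ≤ k ^ (s - 3) * (16 * (m * n)) := by gcongr
    _ = 16 * k ^ (s - 3) * ((m ^ s * m ^ (1 - s - τ / 2) * m ^ (τ / 2)) *
          (n ^ s * n ^ (1 - s - τ / 2) * n ^ (τ / 2))) := by rw [hw m hm0, hw n hn0]; ring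
    _ ≤ 16 * k ^ (s - 3) * ((m ^ s * m ^ (1 - s - τ / 2) * k ^ (τ / 2)) *
          (n ^ s * n ^ (1 - s - τ / 2) * k ^ (τ / 2))) := by
        gcongr <;> linarith
    _ = _ := by rw [ek']; ring

theorem kernel_near_le {k m n s ε S p q : ℝ} (hk1 : 1 ≤ k) (hn : 1 ≤ n) (hnm : n ≤ m)
    (hk : k ≤ 4 * m) (hs : 0 ≤ s) (hε : 0 < ε) (hε1 : ε ≤ 1) (hS : 0 ≤ S) (hp : 1 ≤ p) (hq : 1 ≤ q)
    (hpq : 2 * n ≤ p + q) (h : S * (p * q * (k + m - n) * (k + m + n)) = 4 * k * m * n) :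
    k ^ s * S ≤ m ^ s * n ^ s *
      (4 * 4 ^ s * (n ^ (ε - s) * (p ^ (-(1 + ε)) + q ^ (-(1 + ε))))) := by
  have hk0 : 0 < k := by linarith
  have hm0 : 0 < m := by linarith
  have hn0 : 0 < n := by linarith
  have hp0 : 0 < p := by linarith
  have hq0 : 0 < q := by linarith
  have h1 : S ≤ 4 * (n / (p * q)) := by
    have h2 : S * (p * q * k * m) ≤ 4 * k * m * n := by
      have : 0 < k + m - n := by linarith
      rw [← h]; gcongr <;> linarith
    have h3 : (k * m) * (S * (p * q)) ≤ (k * m) * (4 * n) := by linarith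
    have h4 := le_of_mul_le_mul_left h3 (by positivity)
    rw [← mul_div_assoc, le_div_iff₀ (by positivity)]
    exact h4
  have h2 : n / (p * q) ≤ n ^ ε * (p ^ (-(1 + ε)) + q ^ (-(1 + ε))) := by
    have hp' : 0 ≤ n ^ ε * p ^ (-(1 + ε)) := by positivity
    have hq' : 0 ≤ n ^ ε * q ^ (-(1 + ε)) := by positivity
    rw [mul_add]
    rcases le_total p q with hle | hle
    · have := div_mul_le_rpow hp hle hn0 (by linarith) hε hε1
      linarith
    · have := div_mul_le_rpow hq hle hn0 (by linarith) hε hε1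
      rw [mul_comm q p] at this
      linarith
  have en : n ^ s * n ^ (ε - s) = n ^ ε := by
    rw [← Real.rpow_add hn0]; ring_nf
  calc k ^ s * S ≤ (4 * m) ^ s * (4 * (n ^ ε * (p ^ (-(1 + ε)) + q ^ (-(1 + ε))))) := by
        gcongr
        linarith
    _ = _ := by
        rw [Real.mul_rpow (by norm_num) hm0.le, ← en]; ring

theorem weighted_sinTriple_le_of_le {s τ ε : ℝ} (hs : 0 ≤ s) (hτ : 0 ≤ τ) (hε : 0 < ε)
    (hε1 : ε ≤ 1) {k m n : ℕ} (hnm : n ≤ m) :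
    br k ^ s * |sinTriple k m n| ≤ br m ^ s * br n ^ s *
      (16 * (br k ^ (s - 3 + τ) * br m ^ (1 - s - τ / 2) * br n ^ (1 - s - τ / 2)) +
        4 * 4 ^ s * (br n ^ (ε - s) *
          (br (k - m - n) ^ (-(1 + ε)) + br (k - m + n) ^ (-(1 + ε))))) := by
  have hb : ∀ (j : ℤ) (p : ℝ), 0 ≤ br j ^ p := fun j p => Real.rpow_nonneg (br_pos j).le p
  have hfar : 0 ≤ br m ^ s * br n ^ s *
      (16 * (br k ^ (s - 3 + τ) * br m ^ (1 - s - τ / 2) * br n ^ (1 - s - τ / 2))) :=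
    mul_nonneg (mul_nonneg (hb _ _) (hb _ _))
      (mul_nonneg (by norm_num) (mul_nonneg (mul_nonneg (hb _ _) (hb _ _)) (hb _ _)))
  have hnear : 0 ≤ br m ^ s * br n ^ s * (4 * 4 ^ s * (br n ^ (ε - s) *
          (br (k - m - n) ^ (-(1 + ε)) + br (k - m + n) ^ (-(1 + ε))))) :=
    mul_nonneg (mul_nonneg (hb _ _) (hb _ _)) (mul_nonneg (by positivity)
      (mul_nonneg (hb _ _) (add_nonneg (hb _ _) (hb _ _))))
  rw [mul_add]
  by_cases h0 : sinTriple k m n = 0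
  · rw [h0, abs_zero, mul_zero]
    exact add_nonneg hfar hnear
  have hk : k ≠ 0 := by rintro rfl; simp [sinTriple] at h0
  have hn : n ≠ 0 := by rintro rfl; simp [sinTriple] at h0
  have hm : m ≠ 0 := by omega
  have hodd : Odd ((k : ℤ) + m + n) := by
    rw [← Int.not_even_iff_odd]
    exact fun h => h0 (sinTriple_of_even h)
  have heq := sinTriple_mul_of_odd hodd
  have cast_br : ∀ j : ℕ, j ≠ 0 → br j = j := fun j hj => by
    rw [br_of_ne_zero (by exact_mod_cast hj)]; simp
  have hp0 : (k : ℤ) - m - n ≠ 0 := by grind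
  have hq0 : (k : ℤ) - m + n ≠ 0 := by grind
  have hp := one_le_br (k - m - n)
  have hq := one_le_br (k - m + n)
  have ep := br_of_ne_zero hp0
  have eq := br_of_ne_zero hq0
  have hkR : (1 : ℝ) ≤ k := by exact_mod_cast Nat.one_le_iff_ne_zero.2 hk
  have hnR : (1 : ℝ) ≤ n := by exact_mod_cast Nat.one_le_iff_ne_zero.2 hn
  have hnmR : (n : ℝ) ≤ m := by exact_mod_cast hnm
  have h : |sinTriple k m n| * (br (k - m - n) * br (k - m + n) * ((k : ℝ) + m - n) *
      ((k : ℝ) + m + n)) = 4 * k * m * n := by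
    have h' := congrArg abs heq
    rw [abs_neg, abs_mul, abs_mul, abs_mul, abs_mul, ← ep, ← eq] at h'
    push_cast at h'
    rw [abs_of_nonneg (a := (k : ℝ) + m - n) (by linarith),
      abs_of_nonneg (a := (k : ℝ) + m + n) (by positivity),
      abs_of_nonneg (a := 4 * (k : ℝ) * m * n) (by positivity)] at h'
    exact h'
  rw [cast_br k hk, cast_br m hm, cast_br n hn] at *
  rcases le_total (4 * (m : ℝ)) k with hle | hle
  · refine le_add_of_le_of_nonneg (kernel_far_le hnR hnmR hle hτ (abs_nonneg _) ?_ h) hnear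
    have e1 : br (k - m - n) = (k : ℝ) - m - n := by
      rw [ep]; push_cast; exact abs_of_nonneg (by linarith)
    have e2 : br (k - m + n) = (k : ℝ) - m + n := by
      rw [eq]; push_cast; exact abs_of_nonneg (by linarith)
    rw [e1, e2]
  · refine le_add_of_nonneg_of_le hfar (kernel_near_le hkR hnR hnmR hle hs hε hε1
      (abs_nonneg _) hp hq ?_ h)
    rw [ep, eq]
    push_cast
    linarith [neg_abs_le ((k : ℝ) - m - n), le_abs_self ((k : ℝ) - m + n)]

/-! ### The bilinear estimate for Fourier coefficients -/

theorem ENNReal.add_sq_le_two_mul (x y : ℝ≥0∞) : (x + y) ^ 2 ≤ 2 * x ^ 2 + 2 * y ^ 2 := by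
  calc (x + y) ^ 2 = x ^ 2 + y ^ 2 + 2 * (x * y) := by ring
    _ ≤ x ^ 2 + y ^ 2 + (x ^ 2 + y ^ 2) := by
        gcongr; exact ENNReal.two_mul_le_sq_add_sq x y
    _ = _ := by ring

theorem ofReal_weighted_sinTriple_le_of_le {s τ ε : ℝ} (hs : 0 ≤ s) (hτ : 0 ≤ τ) (hε : 0 < ε)
    (hε1 : ε ≤ 1) {k m n : ℕ} (hnm : n ≤ m) :
    ENNReal.ofReal (br k ^ s) * ENNReal.ofReal |sinTriple k m n| ≤
      ENNReal.ofReal (br m ^ s) * ENNReal.ofReal (br n ^ s) *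
      (16 * (ENNReal.ofReal (br k ^ (s - 3 + τ)) * ENNReal.ofReal (br m ^ (1 - s - τ / 2)) *
          ENNReal.ofReal (br n ^ (1 - s - τ / 2))) +
        ENNReal.ofReal (4 * 4 ^ s) * (ENNReal.ofReal (br n ^ (ε - s)) *
          (ENNReal.ofReal (br (k - m - n) ^ (-(1 + ε))) +
            ENNReal.ofReal (br (k - m + n) ^ (-(1 + ε)))))) := by
  have hb : ∀ (j : ℤ) (p : ℝ), 0 ≤ br j ^ p := fun j p => Real.rpow_nonneg (br_pos j).le p
  have h := ENNReal.ofReal_le_ofReal (weighted_sinTriple_le_of_le hs hτ hε hε1 hnm (k := k))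
  have h16 : ENNReal.ofReal 16 = 16 := by norm_num
  have h4 : (0 : ℝ) ≤ 4 * 4 ^ s := by positivity
  rwa [ENNReal.ofReal_mul (hb _ _), ENNReal.ofReal_mul (mul_nonneg (hb _ _) (hb _ _)),
    ENNReal.ofReal_mul (hb _ _),
    ENNReal.ofReal_add (mul_nonneg (by norm_num) (mul_nonneg (mul_nonneg (hb _ _) (hb _ _)) (hb _ _)))
      (mul_nonneg h4 (mul_nonneg (hb _ _) (add_nonneg (hb _ _) (hb _ _)))),
    ENNReal.ofReal_mul (by norm_num), ENNReal.ofReal_mul (mul_nonneg (hb _ _) (hb _ _)),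
    ENNReal.ofReal_mul (hb _ _), ENNReal.ofReal_mul h4, ENNReal.ofReal_mul (hb _ _),
    ENNReal.ofReal_add (hb _ _) (hb _ _), h16] at h

theorem tsum_ofReal_br_rpow_sq_ne_top {p : ℝ} (hp : p < -1 / 2) :
    ∑' j : ℕ, ENNReal.ofReal (br j ^ p) ^ 2 ≠ ∞ := by
  have h := tsum_nat_br_rpow_ne_top (p := p * 2) (by linarith)
  convert h using 3 with j
  rw [← ENNReal.ofReal_pow (Real.rpow_nonneg (br_pos j).le p), ← Real.rpow_natCast,
    ← Real.rpow_mul (br_pos j).le]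
  norm_num

theorem exists_tsum_weighted_sinTriple_le {s : ℝ} (hs1 : 1 / 2 < s) (hs2 : s < 5 / 2) :
    ∃ C : ℝ≥0∞, C ≠ ∞ ∧ ∀ A : ℕ → ℝ≥0∞,
      ∑' k : ℕ, (ENNReal.ofReal (br k ^ s) *
        ∑' n : ℕ, ∑' m : ℕ, ENNReal.ofReal |sinTriple k m n| * A n * A m) ^ 2 ≤
      C * (∑' n : ℕ, (ENNReal.ofReal (br n ^ s) * A n) ^ 2) ^ 2 := by
  obtain ⟨τ, hτ1, hτ2⟩ : ∃ τ, max 0 (3 - 2 * s) < τ ∧ τ < 5 / 2 - s :=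
    exists_between (max_lt (by linarith) (by linarith))
  obtain ⟨hτ0, hτ3⟩ := max_lt_iff.1 hτ1
  obtain ⟨ε, hε⟩ : ∃ ε, ε = (s - 1 / 2) / 2 := ⟨_, rfl⟩
  set H : ℕ → ℝ≥0∞ := fun k => ENNReal.ofReal (br k ^ (s - 3 + τ)) with hH
  set G : ℕ → ℝ≥0∞ := fun k => ENNReal.ofReal (br k ^ (1 - s - τ / 2)) with hG
  set α : ℕ → ℝ≥0∞ := fun k => ENNReal.ofReal (br k ^ (ε - s)) with hα
  set φ : ℤ → ℝ≥0∞ := fun j => ENNReal.ofReal (br j ^ (-(1 + ε))) with hφ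
  set c : ℝ≥0∞ := ENNReal.ofReal (4 * 4 ^ s) with hc
  set Φ : ℕ → ℕ → ℕ → ℝ≥0∞ := fun k m n => φ (k - m - n) + φ (k - m + n) with hΦ
  set Z : ℝ≥0∞ := ∑' j, φ j + ∑' j, φ j with hZ
  have hHt : ∑' k, H k ^ 2 ≠ ∞ := tsum_ofReal_br_rpow_sq_ne_top (by linarith)
  have hGt : ∑' k, G k ^ 2 ≠ ∞ := tsum_ofReal_br_rpow_sq_ne_top (by linarith)
  have hαt : ∑' k, α k ^ 2 ≠ ∞ := tsum_ofReal_br_rpow_sq_ne_top (by linarith)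
  have hφt : ∑' j, φ j ≠ ∞ := tsum_int_br_rpow_ne_top (by linarith)
  have hZt : Z ≠ ∞ := ENNReal.add_ne_top.2 ⟨hφt, hφt⟩
  have hΦ1 : ∀ m n, ∑' k, Φ k m n ≤ Z := by
    intro m n
    rw [hΦ, ENNReal.tsum_add]
    refine add_le_add ?_ ?_
    · exact ENNReal.tsum_comp_le_tsum_of_injective (f := fun k : ℕ => (k : ℤ) - m - n)
        (fun a b h => by simpa using h) φ
    · exact ENNReal.tsum_comp_le_tsum_of_injective (f := fun k : ℕ => (k : ℤ) - m + n)
        (fun a b h => by simpa using h) φ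
  have hΦ2 : ∀ k n, ∑' m, Φ k m n ≤ Z := by
    intro k n
    rw [hΦ, ENNReal.tsum_add]
    refine add_le_add ?_ ?_
    · exact ENNReal.tsum_comp_le_tsum_of_injective (f := fun m : ℕ => (k : ℤ) - m - n)
        (fun a b h => by simpa using h) φ
    · exact ENNReal.tsum_comp_le_tsum_of_injective (f := fun m : ℕ => (k : ℤ) - m + n)
        (fun a b h => by simpa using h) φ
  refine ⟨2 * (16 ^ 2 * ((∑' k, H k ^ 2) * (∑' k, G k ^ 2) ^ 2)) +
    2 * ((2 * c) ^ 2 * (Z ^ 2 * ∑' k, α k ^ 2)), ?_, ?_⟩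
  · finiteness
  intro A
  set β : ℕ → ℝ≥0∞ := fun n => ENNReal.ofReal (br n ^ s) * A n with hβ
  set Y : ℕ → ℝ≥0∞ := fun k => ∑' n, ∑' m, (α n * β n) * Φ k m n * β m with hY
  have hterm : ∀ k m n : ℕ, ENNReal.ofReal (br k ^ s) *
      (ENNReal.ofReal |sinTriple k m n| * A n * A m) ≤
      16 * H k * ((G n * β n) * (G m * β m)) +
        c * ((α n * β n) * Φ k m n * β m) + c * ((α m * β m) * Φ k n m * β n) := by
    have hle : ∀ k m n : ℕ, n ≤ m → ENNReal.ofReal (br k ^ s) *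
        (ENNReal.ofReal |sinTriple k m n| * A n * A m) ≤
        16 * H k * ((G n * β n) * (G m * β m)) + c * ((α n * β n) * Φ k m n * β m) := by
      intro k m n hnm
      have h := ofReal_weighted_sinTriple_le_of_le (s := s) (τ := τ) (ε := ε) (by linarith)
        hτ0.le (by linarith) (by linarith) hnm (k := k)
      calc _ = ENNReal.ofReal (br k ^ s) * ENNReal.ofReal |sinTriple k m n| * (A n * A m) := by
            ring
        _ ≤ _ := mul_le_mul_left h (A n * A m)
        _ = _ := by simp only [hH, hG, hα, hβ, hc, hΦ, hφ]; ring
    intro k m n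
    rcases le_total n m with h | h
    · exact (hle k m n h).trans le_self_add
    · have h' := hle k n m h
      rw [sinTriple_swap] at h'
      calc _ = ENNReal.ofReal (br k ^ s) *
            (ENNReal.ofReal |sinTriple k m n| * A m * A n) := by ring
        _ ≤ _ := h'
        _ ≤ _ + c * ((α n * β n) * Φ k m n * β m) := le_self_add
        _ = _ := by ring
  have hw : ∀ k : ℕ, ENNReal.ofReal (br k ^ s) *
        ∑' n : ℕ, ∑' m : ℕ, ENNReal.ofReal |sinTriple k m n| * A n * A m ≤
      16 * H k * (∑' n, G n * β n) ^ 2 + 2 * c * Y k := by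
    intro k
    simp_rw [← ENNReal.tsum_mul_left]
    refine (ENNReal.tsum_le_tsum fun n => ENNReal.tsum_le_tsum fun m => hterm k m n).trans ?_
    simp_rw [ENNReal.tsum_add]
    have e1 : ∑' n, ∑' m, 16 * H k * ((G n * β n) * (G m * β m)) =
        16 * H k * (∑' n, G n * β n) ^ 2 := by
      simp_rw [ENNReal.tsum_mul_left, ENNReal.tsum_mul_right]
      ring
    have e2 : ∑' n, ∑' m, c * ((α n * β n) * Φ k m n * β m) = c * Y k := by
      rw [hY]
      simp_rw [ENNReal.tsum_mul_left]
    have e3 : ∑' n, ∑' m, c * ((α m * β m) * Φ k n m * β n) = c * Y k := by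
      rw [ENNReal.tsum_comm, e2]
    rw [e1, e2, e3]
    exact le_of_eq (by ring)
  have hYs : ∑' k, Y k ^ 2 ≤ Z ^ 2 * ∑' n, α n ^ 2 * (∑' n, β n ^ 2) ^ 2 := by
    refine (ENNReal.tsum_sq_tsum_kernel_le Φ Z hΦ1 hΦ2 (fun n => α n * β n) β).trans ?_
    calc _ ≤ Z ^ 2 * ((∑' n, α n ^ 2) * ∑' n, β n ^ 2) * ∑' n, β n ^ 2 := by
          gcongr; exact ENNReal.sq_tsum_mul_le α β
      _ = _ := by rw [ENNReal.tsum_mul_right]; ring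
  calc _ ≤ ∑' k, (2 * (16 * H k * (∑' n, G n * β n) ^ 2) ^ 2 + 2 * (2 * c * Y k) ^ 2) :=
        ENNReal.tsum_le_tsum fun k =>
          (pow_le_pow_left' (hw k) 2).trans (ENNReal.add_sq_le_two_mul _ _)
    _ = 2 * (16 ^ 2 * ((∑' k, H k ^ 2) * ((∑' n, G n * β n) ^ 2) ^ 2)) +
          2 * ((2 * c) ^ 2 * ∑' k, Y k ^ 2) := by
        rw [ENNReal.tsum_add]
        simp_rw [mul_pow, ENNReal.tsum_mul_left, ENNReal.tsum_mul_right, ENNReal.tsum_mul_left]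
        ring
    _ ≤ 2 * (16 ^ 2 * ((∑' k, H k ^ 2) * ((∑' n, G n ^ 2) * ∑' n, β n ^ 2) ^ 2)) +
          2 * ((2 * c) ^ 2 * (Z ^ 2 * ∑' n, α n ^ 2 * (∑' n, β n ^ 2) ^ 2)) := by
        gcongr
        exact ENNReal.sq_tsum_mul_le G β
    _ = _ := by
        rw [ENNReal.tsum_mul_right]; ring

/-! ### Fourier series of odd functions -/

theorem summable_norm_fcoeff {s : ℝ} (hs : 1 / 2 < s) {u : ℝ → ℂ}
    (h : Summable fun k : ℤ => br k ^ (2 * s) * ‖fcoeff u k‖ ^ 2) :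
    Summable fun k : ℤ => ‖fcoeff u k‖ := by
  have hw : Summable fun k : ℤ => br k ^ (-(2 * s)) := summable_br_rpow (by linarith)
  refine Summable.of_nonneg_of_le (fun _ => norm_nonneg _) (fun k => ?_) (hw.add h)
  have hk := br_pos k
  have e1 : br k ^ (-(2 * s)) = (br k ^ (-s)) ^ 2 := by
    rw [← Real.rpow_natCast, ← Real.rpow_mul hk.le]; congr 1; push_cast; ring
  have e2 : br k ^ (2 * s) = (br k ^ s) ^ 2 := by
    rw [← Real.rpow_natCast, ← Real.rpow_mul hk.le]; congr 1; push_cast; ring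
  have e3 : br k ^ (-s) * br k ^ s = 1 := by
    rw [← Real.rpow_add hk]; simp
  have h2 := two_mul_le_add_sq (br k ^ (-s)) (br k ^ s * ‖fcoeff u k‖)
  have h3 : 2 * br k ^ (-s) * (br k ^ s * ‖fcoeff u k‖) = 2 * ‖fcoeff u k‖ := by
    linear_combination 2 * ‖fcoeff u k‖ * e3
  have := norm_nonneg (fcoeff u k)
  rw [e1, e2, ← mul_pow]
  linarith

theorem fcoeff_neg_of_odd {u : ℝ → ℂ} (hodd : ∀ x, u (-x) = -u x) (k : ℤ) :
    fcoeff u (-k) = -fcoeff u k := by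
  rw [fcoeff, fcoeff, ← neg_div, ← intervalIntegral.integral_neg]
  have h := intervalIntegral.integral_comp_neg (a := -Real.pi) (b := Real.pi)
    (fun x : ℝ => u x * Complex.exp (-Complex.I * (-k : ℤ) * x))
  rw [neg_neg] at h
  rw [← h]
  congr 2
  ext x
  rw [hodd]
  push_cast
  ring_nf

theorem hasSum_fourier_two_pi {u : ℝ → ℂ} (hc : Continuous u)
    (hper : ∀ x, u (x + 2 * Real.pi) = u x) (hsum : Summable fun k : ℤ => ‖fcoeff u k‖) (x : ℝ) :
    HasSum (fun k : ℤ => fcoeff u k / Real.sqrt (2 * Real.pi) * Complex.exp (Complex.I * k * x))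
      (u x) := by
  have : Fact (0 < 2 * Real.pi) := ⟨Real.two_pi_pos⟩
  have hp : Function.Periodic u (2 * Real.pi) := hper
  let f : C(AddCircle (2 * Real.pi), ℂ) := ⟨hp.lift, continuous_coinduced_dom.mpr hc⟩
  have hf : ∀ y : ℝ, f (y : AddCircle (2 * Real.pi)) = u y := fun y => rfl
  have hpi : (Real.pi : ℂ) ≠ 0 := by exact_mod_cast Real.pi_ne_zero
  have hsq : ((Real.sqrt (2 * Real.pi) : ℝ) : ℂ) ^ 2 = 2 * Real.pi := by
    norm_cast
    rw [Real.sq_sqrt Real.two_pi_pos.le]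
  have hsq0 : ((Real.sqrt (2 * Real.pi) : ℝ) : ℂ) ≠ 0 := by
    intro h0
    rw [h0] at hsq
    simp [hpi] at hsq
  have hcoef : ∀ k : ℤ, fourierCoeff f k = fcoeff u k / Real.sqrt (2 * Real.pi) := by
    intro k
    rw [fourierCoeff_eq_intervalIntegral f k (-Real.pi), fcoeff, div_div, ← sq, hsq,
      show -Real.pi + 2 * Real.pi = Real.pi by ring, Complex.real_smul, mul_comm, div_eq_mul_inv]
    congr 1
    · refine intervalIntegral.integral_congr fun y _ => ?_
      simp only [hf, fourier_coe_apply, smul_eq_mul]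
      rw [mul_comm]
      congr 2
      push_cast
      field_simp
    · push_cast
      rw [one_mul]
  have hs' : Summable (fourierCoeff f) := by
    refine Summable.of_norm ?_
    simp_rw [hcoef, norm_div]
    exact hsum.div_const _
  have h := has_pointwise_sum_fourier_series_of_summable hs' (x : AddCircle (2 * Real.pi))
  rw [hf] at h
  convert h using 2 with k
  rw [hcoef, fourier_coe_apply, smul_eq_mul]
  congr 2
  push_cast
  field_simp

theorem hasSum_sin_of_odd {u : ℝ → ℂ} (hc : Continuous u)
    (hper : ∀ x, u (x + 2 * Real.pi) = u x) (hodd : ∀ x, u (-x) = -u x)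
    (hsum : Summable fun k : ℤ => ‖fcoeff u k‖) (x : ℝ) :
    HasSum (fun n : ℕ => 2 * Complex.I / Real.sqrt (2 * Real.pi) * fcoeff u n *
      (Real.sin (n * x) : ℂ)) (u x) := by
  have h := (hasSum_fourier_two_pi hc hper hsum x).nat_add_neg
  have h0 : fcoeff u 0 = 0 := by
    have := fcoeff_neg_of_odd hodd 0
    rw [neg_zero] at this
    exact self_eq_neg.1 this
  rw [h0, zero_div, zero_mul, add_zero] at h
  convert h using 2 with n
  rw [fcoeff_neg_of_odd hodd]
  push_cast
  have e1 : Complex.exp (Complex.I * n * x) = Complex.cos (n * x) + Complex.sin (n * x) * Complex.I := by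
    rw [← Complex.exp_mul_I]; ring_nf
  have e2 : Complex.exp (Complex.I * -n * x) =
      Complex.cos (n * x) - Complex.sin (n * x) * Complex.I := by
    rw [show Complex.I * -n * x = (-(n * x : ℂ)) * Complex.I by ring, Complex.exp_mul_I,
      Complex.cos_neg, Complex.sin_neg]
    ring
  rw [e1, e2]
  ring

theorem two_le_sqrt_two_pi : 2 ≤ Real.sqrt (2 * Real.pi) := by
  refine Real.le_sqrt_of_sq_le ?_
  linarith [Real.pi_gt_three]

theorem sign_sq_odd {u : ℝ → ℂ} (hodd : ∀ x, u (-x) = -u x) (x : ℝ) :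
    u (-x) ^ 2 * (Real.sign (-x) : ℂ) = -(u x ^ 2 * (Real.sign x : ℂ)) := by
  rw [hodd, Real.sign_neg]
  push_cast
  ring

theorem fcoeff_sign_sq {u : ℝ → ℂ} (hc : Continuous u) (hodd : ∀ x, u (-x) = -u x) (k : ℤ) :
    fcoeff (fun y => u y ^ 2 * (Real.sign y : ℂ)) k =
      -2 * Complex.I / Real.sqrt (2 * Real.pi) *
        ∫ x in (0 : ℝ)..Real.pi, u x ^ 2 * (Real.sin (k * x) : ℂ) := by
  have hpi := Real.pi_pos.le
  have hu0 : u 0 = 0 := by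
    have := hodd 0
    rw [neg_zero] at this
    exact self_eq_neg.1 this
  have hpos : ∀ x : ℝ, 0 ≤ x → u x ^ 2 * (Real.sign x : ℂ) = u x ^ 2 := by
    intro x hx
    rcases hx.eq_or_lt with rfl | hx
    · simp [hu0]
    · simp [Real.sign_of_pos hx]
  have hce : Continuous fun x : ℝ => u x ^ 2 * Complex.exp (-Complex.I * k * x) := by fun_prop
  have hce' : Continuous fun x : ℝ => u x ^ 2 * Complex.exp (Complex.I * k * x) := by fun_prop
  set w : ℝ → ℂ := fun x => u x ^ 2 * (Real.sign x : ℂ) * Complex.exp (-Complex.I * k * x) with hw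
  have hw1 : ∀ x : ℝ, 0 ≤ x → w x = u x ^ 2 * Complex.exp (-Complex.I * k * x) := by
    intro x hx
    rw [hw]
    simp only [hpos x hx]
  have hw2 : ∀ x : ℝ, 0 ≤ x → w (-x) = -(u x ^ 2 * Complex.exp (Complex.I * k * x)) := by
    intro x hx
    rw [hw]
    simp only [sign_sq_odd hodd, hpos x hx]
    push_cast
    ring_nf
  have hi1 : IntervalIntegrable w MeasureTheory.volume 0 Real.pi := by
    refine (hce.intervalIntegrable 0 Real.pi).congr fun x hx => ?_
    rw [Set.uIoc_of_le hpi] at hx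
    exact (hw1 x hx.1.le).symm
  have hi2 : IntervalIntegrable w MeasureTheory.volume (-Real.pi) 0 := by
    refine (IntervalIntegrable.iff_comp_neg).2 ?_
    rw [neg_neg, neg_zero]
    refine (hce'.neg.intervalIntegrable Real.pi 0).congr fun x hx => ?_
    rw [Set.uIoc_comm, Set.uIoc_of_le hpi] at hx
    exact (hw2 x hx.1.le).symm
  have h1 : ∫ x in (0 : ℝ)..Real.pi, w x =
      ∫ x in (0 : ℝ)..Real.pi, u x ^ 2 * Complex.exp (-Complex.I * k * x) := by
    refine intervalIntegral.integral_congr fun x hx => ?_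
    rw [Set.uIcc_of_le hpi] at hx
    exact hw1 x hx.1
  have h2 : ∫ x in (-Real.pi)..0, w x =
      ∫ x in (0 : ℝ)..Real.pi, (-fun x : ℝ => u x ^ 2 * Complex.exp (Complex.I * k * x)) x := by
    have h := intervalIntegral.integral_comp_neg (a := 0) (b := Real.pi) w
    rw [neg_zero] at h
    rw [← h]
    refine intervalIntegral.integral_congr fun x hx => ?_
    rw [Set.uIcc_of_le hpi] at hx
    exact hw2 x hx.1
  have hfc : fcoeff (fun y => u y ^ 2 * (Real.sign y : ℂ)) k =
      (∫ x in (-Real.pi)..Real.pi, w x) / Real.sqrt (2 * Real.pi) := rfl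
  rw [hfc, ← intervalIntegral.integral_add_adjacent_intervals hi2 hi1, h1, h2,
    ← intervalIntegral.integral_add (hce'.neg.intervalIntegrable _ _) (hce.intervalIntegrable _ _),
    div_mul_eq_mul_div, ← intervalIntegral.integral_const_mul]
  congr 2
  ext x
  have e1 : Complex.exp (Complex.I * k * x) =
      Complex.cos (k * x) + Complex.sin (k * x) * Complex.I := by
    rw [← Complex.exp_mul_I]; ring_nf
  have e2 : Complex.exp (-Complex.I * k * x) =
      Complex.cos (k * x) - Complex.sin (k * x) * Complex.I := by
    rw [show -Complex.I * k * x = (-(k * x : ℂ)) * Complex.I by ring, Complex.exp_mul_I,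
      Complex.cos_neg, Complex.sin_neg]
    ring
  rw [Pi.neg_apply, e1, e2]
  push_cast
  ring

/-- Term-by-term integration of the square of an absolutely convergent sine series. -/
theorem hasSum_integral_sq_mul_sin {u : ℝ → ℂ} {b : ℕ → ℂ} (hbs : Summable fun n => ‖b n‖)
    (hux : ∀ x : ℝ, HasSum (fun n : ℕ => b n * (Real.sin (n * x) : ℂ)) (u x)) (k : ℤ) :
    HasSum (fun p : ℕ × ℕ => b p.1 * b p.2 * (sinTriple k p.2 p.1 : ℂ))
      (∫ x in (0 : ℝ)..Real.pi, u x ^ 2 * (Real.sin (k * x) : ℂ)) := by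
  have hbs2 : Summable fun p : ℕ × ℕ => ‖b p.1‖ * ‖b p.2‖ :=
    hbs.mul_of_nonneg hbs (fun _ => norm_nonneg _) (fun _ => norm_nonneg _)
  have hsin : ∀ y : ℝ, ‖(Real.sin y : ℂ)‖ ≤ 1 := fun y => by
    rw [Complex.norm_real]
    exact Real.abs_sin_le_one y
  have hbsin : ∀ (x : ℝ) (n : ℕ), ‖b n * (Real.sin (n * x) : ℂ)‖ ≤ ‖b n‖ := fun x n => by
    rw [norm_mul]
    exact mul_le_of_le_one_right (norm_nonneg _) (hsin _)
  have huxn : ∀ x : ℝ, Summable fun n : ℕ => ‖b n * (Real.sin (n * x) : ℂ)‖ := fun x =>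
    Summable.of_nonneg_of_le (fun _ => norm_nonneg _) (hbsin x) hbs
  have e : ∀ p : ℕ × ℕ, b p.1 * b p.2 * (sinTriple k p.2 p.1 : ℂ) =
      ∫ x in (0 : ℝ)..Real.pi, (b p.1 * (Real.sin (p.1 * x) : ℂ)) *
        (b p.2 * (Real.sin (p.2 * x) : ℂ)) * (Real.sin (k * x) : ℂ) := by
    intro p
    rw [sinTriple, ← intervalIntegral.integral_ofReal, ← intervalIntegral.integral_const_mul]
    congr 1
    ext x
    push_cast
    ring
  simp_rw [e]
  refine intervalIntegral.hasSum_integral_of_dominated_convergence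
    (fun p _ => ‖b p.1‖ * ‖b p.2‖) (fun p => ?_) (fun p => ?_) ?_ ?_ ?_
  · exact Continuous.aestronglyMeasurable (by fun_prop)
  · refine Filter.Eventually.of_forall fun x _ => ?_
    rw [norm_mul, norm_mul]
    refine (mul_le_of_le_one_right (by positivity) (hsin _)).trans ?_
    exact mul_le_mul (hbsin x p.1) (hbsin x p.2) (norm_nonneg _) (norm_nonneg _)
  · exact Filter.Eventually.of_forall fun x _ => hbs2
  · exact intervalIntegrable_const
  · refine Filter.Eventually.of_forall fun x _ => ?_
    rw [sq]
    have hprod : Summable fun p : ℕ × ℕ => (b p.1 * (Real.sin (p.1 * x) : ℂ)) *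
        (b p.2 * (Real.sin (p.2 * x) : ℂ)) :=
      summable_mul_of_summable_norm (R := ℂ) (f := fun n : ℕ => b n * (Real.sin (n * x) : ℂ))
        (g := fun n : ℕ => b n * (Real.sin (n * x) : ℂ)) (huxn x) (huxn x)
    have h := HasSum.mul (hux x) (hux x) hprod
    exact h.mul_right _

theorem enorm_fcoeff_sign_sq_le {u : ℝ → ℂ} (hc : Continuous u)
    (hper : ∀ x, u (x + 2 * Real.pi) = u x) (hodd : ∀ x, u (-x) = -u x)
    (hsum : Summable fun k : ℤ => ‖fcoeff u k‖) (k : ℤ) :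
    ‖fcoeff (fun y => u y ^ 2 * (Real.sign y : ℂ)) k‖ₑ ≤
      ∑' n : ℕ, ∑' m : ℕ, ENNReal.ofReal |sinTriple k m n| * ‖fcoeff u n‖ₑ * ‖fcoeff u m‖ₑ := by
  have hsqrt := two_le_sqrt_two_pi
  have hcoef : ‖2 * Complex.I / (Real.sqrt (2 * Real.pi) : ℂ)‖ ≤ 1 := by
    rw [norm_div, norm_mul, Complex.norm_I, Complex.norm_real, Real.norm_of_nonneg (by positivity),
      div_le_one (by linarith)]
    simpa using hsqrt
  have hone : ‖-2 * Complex.I / (Real.sqrt (2 * Real.pi) : ℂ)‖ₑ ≤ 1 := by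
    rw [neg_mul, neg_div, enorm_neg, ← ofReal_norm]
    exact ENNReal.ofReal_le_one.2 hcoef
  set b : ℕ → ℂ := fun n => 2 * Complex.I / Real.sqrt (2 * Real.pi) * fcoeff u n with hb
  have hba : ∀ n : ℕ, ‖b n‖ ≤ ‖fcoeff u n‖ := fun n => by
    rw [hb, norm_mul]
    exact mul_le_of_le_one_left (norm_nonneg _) hcoef
  have hbs : Summable fun n => ‖b n‖ :=
    Summable.of_nonneg_of_le (fun _ => norm_nonneg _) hba
      (hsum.comp_injective (Nat.cast_injective (R := ℤ)))
  have hint := hasSum_integral_sq_mul_sin hbs (hasSum_sin_of_odd hc hper hodd hsum) k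
  have hle : ∀ n : ℕ, ‖b n‖ₑ ≤ ‖fcoeff u n‖ₑ := fun n => enorm_le_iff_norm_le.2 (hba n)
  have hterm : ∀ p : ℕ × ℕ, ‖b p.1 * b p.2 * (sinTriple k p.2 p.1 : ℂ)‖ₑ ≤
      ENNReal.ofReal |sinTriple k p.2 p.1| * ‖fcoeff u p.1‖ₑ * ‖fcoeff u p.2‖ₑ := by
    intro p
    have hS : ‖(sinTriple k p.2 p.1 : ℂ)‖ₑ = ENNReal.ofReal |sinTriple k p.2 p.1| := by
      rw [← ofReal_norm, Complex.norm_real, Real.norm_eq_abs]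
    rw [enorm_mul, enorm_mul, hS, mul_comm, ← mul_assoc]
    exact mul_le_mul' (mul_le_mul_right (hle _) _) (hle _)
  rw [fcoeff_sign_sq hc hodd, enorm_mul, ← hint.tsum_eq, ← ENNReal.tsum_prod
    (f := fun n m : ℕ => ENNReal.ofReal |sinTriple k m n| * ‖fcoeff u n‖ₑ * ‖fcoeff u m‖ₑ)]
  exact (mul_le_of_le_one_left' hone).trans
    (enorm_tsum_le_tsum_enorm.trans (ENNReal.tsum_le_tsum hterm))

theorem ofReal_br_rpow_mul_norm_sq (s : ℝ) (z : ℂ) (k : ℤ) :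
    ENNReal.ofReal (br k ^ (2 * s) * ‖z‖ ^ 2) = (ENNReal.ofReal (br k ^ s) * ‖z‖ₑ) ^ 2 := by
  have h := Real.rpow_nonneg (br_pos k).le s
  rw [← ofReal_norm, ← ENNReal.ofReal_mul h,
    ← ENNReal.ofReal_pow (mul_nonneg h (norm_nonneg _)), mul_pow, ← Real.rpow_natCast (br k ^ s),
    ← Real.rpow_mul (br_pos k).le, mul_comm 2 s]
  norm_num

theorem tsum_int_le_two_mul_of_even {f : ℤ → ℝ≥0∞} (hf : ∀ k, f (-k) = f k) :
    ∑' k : ℤ, f k ≤ 2 * ∑' n : ℕ, f n := by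
  rw [tsum_of_nat_of_neg_add_one ENNReal.summable ENNReal.summable, two_mul]
  refine add_le_add_right ?_ _
  simp_rw [hf]
  exact_mod_cast ENNReal.tsum_comp_le_tsum_of_injective Nat.succ_injective fun n : ℕ => f n

/-- for `1/2 < s < 5/2` the operator `T^c₁(u) := u² sgn(x)` maps the space
`H^s_o` of odd 2π-periodic `H^s` functions into itself, and `‖u² sgn‖_s ≤ C₇(s) ‖u‖²_s`. -/
theorem sign_square_bounded (s : ℝ) (hs1 : 1/2 < s) (hs2 : s < 5/2) :
    ∃ C : ℝ, 0 < C ∧ ∀ u : ℝ → ℂ,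
      Continuous u →
      (∀ x : ℝ, u (x + 2*Real.pi) = u x) →
      (∀ x : ℝ, u (-x) = - u x) →
      Summable (fun k : ℤ => br k ^ (2*s) * ‖fcoeff u k‖^2) →
      (∀ x : ℝ, (fun y => (u y)^2 * (Real.sign y : ℂ)) (-x)
          = - (fun y => (u y)^2 * (Real.sign y : ℂ)) x) ∧
      Summable (fun k : ℤ =>
        br k ^ (2*s) * ‖fcoeff (fun y => (u y)^2 * (Real.sign y : ℂ)) k‖^2) ∧
      snorm s (fun y => (u y)^2 * (Real.sign y : ℂ)) ≤ C * (snorm s u)^2 := by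
  obtain ⟨C, hC, hbound⟩ := exists_tsum_weighted_sinTriple_le hs1 hs2
  refine ⟨Real.sqrt (2 * C.toReal) + 1, by positivity, fun u hc hper hodd hu => ?_⟩
  have hvodd := sign_sq_odd hodd
  refine ⟨hvodd, ?_⟩
  have hnn : ∀ (f : ℝ → ℂ) (k : ℤ), 0 ≤ br k ^ (2 * s) * ‖fcoeff f k‖ ^ 2 := fun f k =>
    mul_nonneg (Real.rpow_nonneg (br_pos k).le _) (by positivity)
  set v : ℝ → ℂ := fun y => (u y) ^ 2 * (Real.sign y : ℂ) with hv
  set T : ℝ := ∑' k : ℤ, br k ^ (2 * s) * ‖fcoeff u k‖ ^ 2 with hT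
  have hT0 : 0 ≤ T := tsum_nonneg (hnn u)
  have hsum := summable_norm_fcoeff hs1 hu
  have hmain : ∑' k : ℤ, ENNReal.ofReal (br k ^ (2 * s) * ‖fcoeff v k‖ ^ 2) ≤
      ENNReal.ofReal (2 * C.toReal * T ^ 2) := by
    calc _ ≤ 2 * ∑' k : ℕ, ENNReal.ofReal (br k ^ (2 * s) * ‖fcoeff v k‖ ^ 2) :=
          tsum_int_le_two_mul_of_even
            (f := fun k : ℤ => ENNReal.ofReal (br k ^ (2 * s) * ‖fcoeff v k‖ ^ 2))
            fun k => by rw [br_neg, fcoeff_neg_of_odd hvodd, norm_neg]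
      _ ≤ 2 * (C * (∑' n : ℕ, (ENNReal.ofReal (br n ^ s) * ‖fcoeff u n‖ₑ) ^ 2) ^ 2) := by
          gcongr
          refine le_trans (ENNReal.tsum_le_tsum fun k => ?_) (hbound fun n => ‖fcoeff u n‖ₑ)
          rw [ofReal_br_rpow_mul_norm_sq]
          gcongr
          exact enorm_fcoeff_sign_sq_le hc hper hodd hsum k
      _ ≤ 2 * (C * ENNReal.ofReal T ^ 2) := by
          gcongr
          rw [hT, ENNReal.ofReal_tsum_of_nonneg (hnn u) hu]
          simp_rw [← ofReal_br_rpow_mul_norm_sq]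
          exact ENNReal.tsum_comp_le_tsum_of_injective (Nat.cast_injective (R := ℤ))
            fun k : ℤ => ENNReal.ofReal (br k ^ (2 * s) * ‖fcoeff u k‖ ^ 2)
      _ = _ := by
          rw [ENNReal.ofReal_mul (by positivity), ENNReal.ofReal_mul (by norm_num),
            ENNReal.ofReal_toReal hC, ENNReal.ofReal_pow hT0, mul_assoc]
          norm_num
  have hvsum : Summable fun k : ℤ => br k ^ (2 * s) * ‖fcoeff v k‖ ^ 2 := by
    have h := ENNReal.summable_toReal (ne_top_of_le_ne_top ENNReal.ofReal_ne_top hmain)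
    simpa only [ENNReal.toReal_ofReal (hnn v _)] using h
  refine ⟨hvsum, ?_⟩
  rw [← ENNReal.ofReal_tsum_of_nonneg (hnn v) hvsum,
    ENNReal.ofReal_le_ofReal_iff (by positivity)] at hmain
  have hsn : snorm s u ^ 2 = T := Real.sq_sqrt hT0
  calc snorm s v ≤ Real.sqrt (2 * C.toReal * T ^ 2) := Real.sqrt_le_sqrt hmain
    _ = Real.sqrt (2 * C.toReal) * T := by
        rw [Real.sqrt_mul (by positivity), Real.sqrt_sq hT0]
    _ ≤ _ := by
        rw [hsn]
        gcongr
        linarith
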